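/- (Proposition A.2: projected controllability of a constrained linear time-varying system.) Let A : ℝ → ℝ^{d×d} and B : ℝ → ℝ^{d×m} be smooth, let V ⊆ ℝ^m be compact with 0 ∈ V, let t₀ < t_f, let φ be the transition matrix of A, and let P : ℝ^d → ℝⁿ be a surjective linear map with n ≤ d. Then the image P(𝖠^V_{t₀,t_f}(0)) is a neighborhood of the origin in ℝⁿ if and only if cone{P·φ(t_f,s)B(s)v : s ∈ [t₀,t_f], v ∈ V} = ℝⁿ. -/

import Mathlib

open Set MeasureTheory

noncomputable section

/-- Conic hull of a set: all finite conic combinations of elements of `S`. -/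
def coneHull {V : Type*} [AddCommMonoid V] [Module ℝ V] (S : Set V) : Set V :=
  {y | ∃ (j : ℕ) (v : Fin j → V) (c : Fin j → ℝ),
    (∀ i, v i ∈ S) ∧ (∀ i, 0 ≤ c i) ∧ y = ∑ i, c i • v i}

/-- Accessible set from `0` of the constrained linear time-varying system
`ż = A(t)z + B(t)v`, `v ∈ V`, expressed by variation of constants through the
transition matrix `φ` of `A`. -/
def ltvAccess {d m : ℕ} (B : ℝ → Matrix (Fin d) (Fin m) ℝ)
    (φ : ℝ → ℝ → Matrix (Fin d) (Fin d) ℝ) (V : Set (Fin m → ℝ)) (t0 tf : ℝ) :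
    Set (Fin d → ℝ) :=
  {z | ∃ v : ℝ → Fin m → ℝ, Measurable v ∧ (∀ s ∈ Icc t0 tf, v s ∈ V) ∧
    z = ∫ s in t0..tf, (φ tf s).mulVec ((B s).mulVec (v s))}

open scoped Pointwise

universe u

section ConeHull

variable {E : Type*} [AddCommGroup E] [Module ℝ E] {S : Set E}

theorem subset_coneHull : S ⊆ coneHull S := fun x hx =>
  ⟨1, fun _ => x, fun _ => 1, fun _ => hx, fun _ => zero_le_one, by simp⟩

theorem zero_mem_coneHull : (0 : E) ∈ coneHull S :=
  ⟨0, Fin.elim0, Fin.elim0, fun i => i.elim0, fun i => i.elim0, by simp⟩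

theorem add_mem_coneHull {x y : E} (hx : x ∈ coneHull S) (hy : y ∈ coneHull S) :
    x + y ∈ coneHull S := by
  obtain ⟨j, v, c, hv, hc, rfl⟩ := hx
  obtain ⟨k, w, b, hw, hb, rfl⟩ := hy
  refine ⟨j + k, Fin.append v w, Fin.append c b, fun i => ?_, fun i => ?_, ?_⟩
  · refine Fin.addCases (fun i => ?_) (fun i => ?_) i <;> simp [hv, hw]
  · refine Fin.addCases (fun i => ?_) (fun i => ?_) i <;> simp [hc, hb]
  · simp [Fin.sum_univ_add]

theorem smul_mem_coneHull {x : E} {r : ℝ} (hr : 0 ≤ r) (hx : x ∈ coneHull S) :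
    r • x ∈ coneHull S := by
  obtain ⟨j, v, c, hv, hc, rfl⟩ := hx
  exact ⟨j, v, fun i => r * c i, hv, fun i => mul_nonneg hr (hc i), by
    simp [Finset.smul_sum, mul_smul]⟩

theorem convex_coneHull : Convex ℝ (coneHull S) := fun _ hx _ hy _ _ ha hb _ =>
  add_mem_coneHull (smul_mem_coneHull ha hx) (smul_mem_coneHull hb hy)

theorem coneHull_subset_span : coneHull S ⊆ Submodule.span ℝ S := by
  rintro _ ⟨j, v, c, hv, -, rfl⟩
  exact Submodule.sum_mem _ fun i _ => Submodule.smul_mem _ _ (Submodule.subset_span (hv i))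

end ConeHull

/-- A proper convex cone in a finite-dimensional space lies in a closed half-space. -/
theorem exists_ne_zero_forall_nonpos_of_coneHull_ne_univ {E : Type*} [NormedAddCommGroup E]
    [NormedSpace ℝ E] [FiniteDimensional ℝ E] {S : Set E} (hS : coneHull S ≠ univ) :
    ∃ f : E →L[ℝ] ℝ, f ≠ 0 ∧ ∀ x ∈ S, f x ≤ 0 := by
  by_cases hint : (interior (coneHull S)).Nonempty
  · obtain ⟨x, hx⟩ := (ne_univ_iff_exists_notMem _).1 hS
    obtain ⟨f, hf, hfx⟩ := geometric_hahn_banach_of_nonempty_interior_point convex_coneHull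
      (fun h => hx (interior_subset h)) hint
    refine ⟨f, hf, fun y hy => ?_⟩
    by_contra! hpos
    have h0 : 0 ≤ f x := by simpa using hfx 0 zero_mem_coneHull
    have h := hfx _ (smul_mem_coneHull (r := (f x + 1) / f y) (by positivity)
      (subset_coneHull hy))
    rw [map_smul, smul_eq_mul, div_mul_cancel₀ _ hpos.ne'] at h
    linarith
  · have hspan : Submodule.span ℝ S < ⊤ := by
      rw [lt_top_iff_ne_top]
      intro htop
      apply hint
      rw [convex_coneHull.interior_nonempty_iff_affineSpan_eq_top,
        AffineSubspace.affineSpan_eq_top_iff_vectorSpan_eq_top_of_nonempty ℝ E E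
          ⟨0, zero_mem_coneHull⟩, eq_top_iff, ← htop, Submodule.span_le]
      intro x hx
      simpa using vsub_mem_vectorSpan ℝ (subset_coneHull hx) (zero_mem_coneHull (S := S))
    obtain ⟨f, hf, hle⟩ := Submodule.exists_le_ker_of_lt_top _ hspan
    refine ⟨f.toContinuousLinearMap, fun h => hf ?_, fun x hx => ?_⟩
    · ext x
      simpa using congrArg (fun g : E →L[ℝ] ℝ => g x) h
    · exact (show f x = 0 from hle (Submodule.subset_span hx)).le

/-- A set whose conic hull is the whole finite-dimensional space contains a finite spanning
family admitting a vanishing linear combination with positive coefficients. -/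
theorem exists_pos_combination_eq_zero_of_coneHull_eq_univ {E : Type u} [AddCommGroup E]
    [Module ℝ E] [FiniteDimensional ℝ E] {S : Set E} (hS : coneHull S = univ) :
    ∃ (ι : Type u) (_ : Fintype ι) (w : ι → E) (c : ι → ℝ), (∀ i, w i ∈ S) ∧ (∀ i, 0 < c i) ∧
      ∑ i, c i • w i = 0 ∧ Submodule.span ℝ (range w) = ⊤ := by
  have htop : Submodule.span ℝ S = ⊤ := by
    rw [eq_top_iff]
    intro x _
    exact coneHull_subset_span (hS ▸ mem_univ x)
  obtain ⟨T, hTS, hT⟩ := (Submodule.fg_span_iff_fg_span_finset_subset (R := ℝ) S).1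
    (IsNoetherian.noetherian _)
  obtain ⟨j, v, c, hv, hc, hsum⟩ : -∑ x ∈ T, x ∈ coneHull S := hS ▸ mem_univ _
  let w : T ⊕ Fin j → E := Sum.elim (fun x => x) v
  let b : T ⊕ Fin j → ℝ := Sum.elim (fun _ => 1) c
  refine ⟨{i // 0 < b i}, inferInstance, fun i => w i, fun i => b i, ?_, fun i => i.2, ?_, ?_⟩
  · rintro ⟨i | i, -⟩
    exacts [hTS i.2, hv i]
  · have hall : ∑ i, b i • w i = 0 := by
      simp [b, w, Fintype.sum_sum_type, ← hsum, Finset.sum_attach T fun x => x]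
    rw [← hall, ← Finset.sum_subtype (Finset.univ.filter fun i => 0 < b i) (by simp)
      fun i => b i • w i]
    refine Finset.sum_filter_of_ne fun i _ hi => lt_of_le_of_ne ?_ fun h => hi (by simp [← h])
    rcases i with i | i
    exacts [zero_le_one, hc i]
  · rw [eq_top_iff, ← htop, hT, Submodule.span_le]
    intro x hx
    exact Submodule.subset_span ⟨⟨Sum.inl ⟨x, hx⟩, by simp [b]⟩, rfl⟩

/-- A map on the unit cube which is close in the Lipschitz sense to the linear map with positively
balanced spanning columns `w i` covers a neighborhood of the origin. -/
theorem exists_forall_image_Icc_mem_nhds_zero {ι E : Type*} [Fintype ι] [NormedAddCommGroup E]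
    [NormedSpace ℝ E] [FiniteDimensional ℝ E] {w : ι → E} {c : ι → ℝ} (hc : ∀ i, 0 < c i)
    (hsum : ∑ i, c i • w i = 0) (hspan : Submodule.span ℝ (range w) = ⊤) :
    ∃ δ > 0, ∀ f : (ι → ℝ) → E, f 0 = 0 →
      (∀ h ∈ Icc (0 : ι → ℝ) 1, ∀ h' ∈ Icc (0 : ι → ℝ) 1,
        ‖f h - f h' - ∑ i, (h i - h' i) • w i‖ ≤ δ * ‖h - h'‖) →
      f '' Icc 0 1 ∈ nhds 0 := by
  have hC : 0 ≤ ∑ i, c i := Finset.sum_nonneg fun i _ => (hc i).le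
  let b : ι → ℝ := fun i => c i / (1 + ∑ i, c i)
  have hb : b ∈ univ.pi fun _ : ι => Ioo (0 : ℝ) 1 := by
    intro i _
    have := Finset.single_le_sum (fun i _ => (hc i).le) (Finset.mem_univ i)
    refine ⟨div_pos (hc i) (by linarith), (div_lt_one (by linarith)).2 (by linarith)⟩
  have hbsum : ∑ i, b i • w i = 0 := by
    simp only [b, div_eq_inv_mul, mul_smul]
    rw [← Finset.smul_sum, hsum, smul_zero]
  obtain ⟨ρ, hρ, hball⟩ := Metric.nhds_basis_closedBall.mem_iff.1
    ((isOpen_set_pi finite_univ fun _ _ => isOpen_Ioo).mem_nhds hb)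
  have hcube : Metric.closedBall b ρ ⊆ Icc 0 1 := fun x hx =>
    ⟨fun i => (hball hx i trivial).1.le, fun i => (hball hx i trivial).2.le⟩
  have hbcube : b ∈ Icc (0 : ι → ℝ) 1 := hcube (Metric.mem_closedBall_self hρ.le)
  have hbnorm : ‖b‖ ≤ 1 := (pi_norm_le_iff_of_nonneg zero_le_one).2 fun i => by
    rw [Real.norm_of_nonneg (hbcube.1 i)]
    exact hbcube.2 i
  let L : (ι → ℝ) →L[ℝ] E := (Fintype.linearCombination ℝ w).toContinuousLinearMap
  have hL : ∀ h, L h = ∑ i, h i • w i := fun h => Fintype.linearCombination_apply ℝ w h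
  have hLsurj : L.range = ⊤ := by
    rw [← hspan, ← Fintype.range_linearCombination ℝ w]
    rfl
  let R := L.nonlinearRightInverseOfSurjective hLsurj
  have hR : 0 < (R.nnnorm : ℝ) := L.nonlinearRightInverseOfSurjective_nnnorm_pos hLsurj
  let δ : ℝ := (R.nnnorm : ℝ)⁻¹ * ρ / (2 * (1 + ρ))
  have hδ : 0 < δ := by positivity
  have hδ' : δ * (1 + ρ) < (R.nnnorm : ℝ)⁻¹ * ρ := by
    have h1 : δ * (1 + ρ) = (R.nnnorm : ℝ)⁻¹ * ρ / 2 := by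
      simp only [δ]
      field_simp
    have : 0 < (R.nnnorm : ℝ)⁻¹ * ρ := by positivity
    linarith
  refine ⟨δ, hδ, fun f hf0 hf => ?_⟩
  have happ : ApproximatesLinearOn f L (Icc 0 1) δ.toNNReal := by
    intro h hh h' hh'
    rw [hL, Real.coe_toNNReal δ hδ.le]
    exact hf h hh h' hh'
  have hsurj := happ.surjOn_closedBall_of_nonlinearRightInverse R hρ.le hcube
  have hfb : ‖f b‖ ≤ δ := by
    have h := hf b hbcube 0 ⟨le_rfl, zero_le_one⟩
    simp only [hf0, Pi.zero_apply, sub_zero, hbsum] at h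
    exact h.trans (mul_le_of_le_one_right hδ.le hbnorm)
  refine Filter.mem_of_superset (Metric.closedBall_mem_nhds_of_mem ?_)
    (hsurj.trans (image_mono hcube))
  rw [Metric.mem_ball, dist_eq_norm, zero_sub, norm_neg, Real.coe_toNNReal δ hδ.le]
  nlinarith

theorem norm_sum_integral_sub_le {ι E : Type*} [Fintype ι] [NormedAddCommGroup E]
    [NormedSpace ℝ E] [CompleteSpace E] {g : ι → ℝ → E} (hg : ∀ i, Continuous (g i)) {w : ι → E}
    {a : ι → ℝ} {ε δ : ℝ} (hε : 0 < ε) (hδ : 0 ≤ δ)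
    (hgw : ∀ i, ∀ s ∈ Icc (a i) (a i + ε), ‖g i s - w i‖ ≤ δ) {h h' : ι → ℝ}
    (hh : h ∈ Icc (0 : ι → ℝ) 1) (hh' : h' ∈ Icc (0 : ι → ℝ) 1) :
    ‖∑ i, ε⁻¹ • (∫ s in a i..a i + ε * h i, g i s) -
      ∑ i, ε⁻¹ • (∫ s in a i..a i + ε * h' i, g i s) - ∑ i, (h i - h' i) • w i‖ ≤
      Fintype.card ι * δ * ‖h - h'‖ := by
  rw [← Finset.sum_sub_distrib, ← Finset.sum_sub_distrib, mul_assoc, ← nsmul_eq_mul,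
    ← Finset.card_univ]
  refine (norm_sum_le _ _).trans (Finset.sum_le_card_nsmul _ _ _ fun i _ => ?_)
  have hint : ∀ x y, IntervalIntegrable (g i) volume x y := fun x y =>
    (hg i).intervalIntegrable x y
  have hbd : ∀ k ∈ Icc (0 : ι → ℝ) 1, a i + ε * k i ∈ Icc (a i) (a i + ε) := fun k hk =>
    ⟨le_add_of_nonneg_right (mul_nonneg hε.le (hk.1 i)),
      add_le_add_right (mul_le_of_le_one_right hε.le (hk.2 i)) _⟩
  have key : ε⁻¹ • (∫ s in a i..a i + ε * h i, g i s) -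
      ε⁻¹ • (∫ s in a i..a i + ε * h' i, g i s) - (h i - h' i) • w i =
      ε⁻¹ • ∫ s in a i + ε * h' i..a i + ε * h i, (g i s - w i) := by
    rw [intervalIntegral.integral_sub (hint _ _) intervalIntegrable_const,
      intervalIntegral.integral_const, ← smul_sub,
      intervalIntegral.integral_interval_sub_left (hint _ _) (hint _ _), smul_sub, smul_smul]
    congr 2
    field_simp
    ring
  have hnorm : ‖∫ s in a i + ε * h' i..a i + ε * h i, (g i s - w i)‖ ≤
      δ * |a i + ε * h i - (a i + ε * h' i)| :=
    intervalIntegral.norm_integral_le_of_norm_le_const fun s hs =>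
      hgw i s (uIcc_subset_Icc (hbd h' hh') (hbd h hh) (uIoc_subset_uIcc hs))
  rw [key, norm_smul, norm_inv, Real.norm_of_nonneg hε.le, inv_mul_le_iff₀ hε]
  refine hnorm.trans ?_
  rw [add_sub_add_left_eq_sub, ← mul_sub, abs_mul, abs_of_pos hε]
  have : |h i - h' i| ≤ ‖h - h'‖ := norm_le_pi_norm (h - h') i
  calc δ * (ε * |h i - h' i|) ≤ δ * (ε * ‖h - h'‖) := by gcongr
    _ = ε * (δ * ‖h - h'‖) := by ring

/-- Finitely many infinite sets have pairwise distinct representatives. -/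
theorem exists_injective_forall_mem_of_infinite {ι α : Type*} [Finite ι] {O : ι → Set α}
    (hO : ∀ i, (O i).Infinite) : ∃ a : ι → α, Function.Injective a ∧ ∀ i, a i ∈ O i := by
  classical
  have := Fintype.ofFinite ι
  choose T hTO hT using fun i => (hO i).exists_subset_card_eq (Fintype.card ι)
  obtain ⟨a, ha, haT⟩ := (Finset.all_card_le_biUnion_card_iff_exists_injective T).1 fun s => by
    obtain rfl | ⟨i, hi⟩ := s.eq_empty_or_nonempty
    · simp
    · exact (s.card_le_univ.trans (hT i).ge).trans
        (Finset.card_le_card (Finset.subset_biUnion_of_mem T hi))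
  exact ⟨a, ha, fun i => hTO i (haT i)⟩

/-- Points of `[t₀, t₁]`, possibly repeated, can be approximated by pairwise disjoint short
intervals of a common length. -/
theorem exists_disjoint_intervals {ι : Type*} [Finite ι] {t₀ t₁ : ℝ} (ht : t₀ < t₁) {s : ι → ℝ}
    (hs : ∀ i, s i ∈ Icc t₀ t₁) {U : ι → Set ℝ} (hU : ∀ i, U i ∈ nhds (s i)) :
    ∃ (a : ι → ℝ) (ε : ℝ), 0 < ε ∧ (∀ i, Icc (a i) (a i + ε) ⊆ U i ∩ Icc t₀ t₁) ∧
      ∀ i j, i ≠ j → Disjoint (Ioc (a i) (a i + ε)) (Ioc (a j) (a j + ε)) := by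
  have hopen : ∀ i, IsOpen (interior (U i) ∩ Ioo t₀ t₁) := fun i =>
    isOpen_interior.inter isOpen_Ioo
  obtain ⟨a, ha, haO⟩ := exists_injective_forall_mem_of_infinite
    (O := fun i => interior (U i) ∩ Ioo t₀ t₁) fun i => by
      obtain ⟨x, hx⟩ := mem_closure_iff.1 (closure_Ioo ht.ne ▸ hs i) _ isOpen_interior
        (mem_interior_iff_mem_nhds.2 (hU i))
      exact infinite_of_mem_nhds x ((hopen i).mem_nhds hx)
  have h1 : ∀ᶠ ε in nhdsWithin (0 : ℝ) (Ioi 0), ∀ i, Icc (a i) (a i + ε) ⊆ U i ∩ Icc t₀ t₁ := by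
    refine Filter.eventually_all.2 fun i => ?_
    obtain ⟨r, hr, hball⟩ := Metric.isOpen_iff.1 (hopen i) _ (haO i)
    filter_upwards [Ioo_mem_nhdsGT hr] with ε hε x hx
    have := hball (show x ∈ Metric.ball (a i) r by
      rw [Metric.mem_ball, Real.dist_eq, abs_of_nonneg (by linarith [hx.1])]
      linarith [hx.2, hε.2])
    exact ⟨interior_subset this.1, Ioo_subset_Icc_self this.2⟩
  have h2 : ∀ᶠ ε in nhdsWithin (0 : ℝ) (Ioi 0), ∀ i j, i ≠ j → ε < |a i - a j| := by
    refine Filter.eventually_all.2 fun i => Filter.eventually_all.2 fun j => ?_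
    by_cases hij : i = j
    · simp [hij]
    · have : 0 < |a i - a j| := abs_pos.2 (sub_ne_zero.2 (ha.ne hij))
      filter_upwards [Ioo_mem_nhdsGT this] with ε hε _ using hε.2
  obtain ⟨ε, ⟨hε1, hε2⟩, hε⟩ := ((h1.and h2).and self_mem_nhdsWithin).exists
  refine ⟨a, ε, hε, hε1, fun i j hij => Set.disjoint_left.2 fun x hx hx' => ?_⟩
  have := hε2 i j hij
  obtain h | h := lt_abs.1 this <;> linarith [hx.1, hx.2, hx'.1, hx'.2]

theorem continuous_transition_snd {d : ℕ} {A : ℝ → Matrix (Fin d) (Fin d) ℝ}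
    {φ : ℝ → ℝ → Matrix (Fin d) (Fin d) ℝ} (hφid : ∀ t, φ t t = 1)
    (hφmul : ∀ t1 t2 t3, φ t3 t2 * φ t2 t1 = φ t3 t1)
    (hφder : ∀ t1 t i j, HasDerivAt (fun s => φ s t1 i j) ((A t * φ t t1) i j) t) (t : ℝ) :
    Continuous (φ t) := by
  have hfst : Continuous fun s => φ s t := continuous_matrix fun i j =>
    continuous_iff_continuousAt.2 fun s => (hφder t s i j).continuousAt
  have hinv : ∀ s, φ t s * φ s t = 1 := fun s => by rw [hφmul, hφid]
  have hdet : ∀ s, (φ s t).det ≠ 0 := fun s h => by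
    simpa [h] using congrArg Matrix.det (hinv s)
  have heq : φ t = fun s => (φ s t).det⁻¹ • (φ s t).adjugate := by
    funext s
    rw [← Matrix.inv_eq_left_inv (hinv s), Matrix.inv_def, Ring.inverse_eq_inv']
  rw [heq]
  exact (hfst.matrix_det.inv₀ hdet).smul hfst.matrix_adjugate

/-- Switching successively between finitely many constant controls on disjoint intervals. -/
theorem sum_integral_mem_ltvAccess {ι : Type*} [Fintype ι] {d m : ℕ}
    {B : ℝ → Matrix (Fin d) (Fin m) ℝ} {φ : ℝ → ℝ → Matrix (Fin d) (Fin d) ℝ}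
    {V : Set (Fin m → ℝ)} (hV0 : 0 ∈ V) {t0 tf : ℝ} (ht : t0 ≤ tf) (hB : Continuous B)
    (hφ : Continuous (φ tf)) {v : ι → Fin m → ℝ} (hv : ∀ i, v i ∈ V) {a b : ι → ℝ}
    (hab : ∀ i, a i ≤ b i) (hsub : ∀ i, Ioc (a i) (b i) ⊆ Ioc t0 tf)
    (hdisj : ∀ i j, i ≠ j → Disjoint (Ioc (a i) (b i)) (Ioc (a j) (b j))) :
    ∑ i, ∫ s in a i..b i, (φ tf s).mulVec ((B s).mulVec (v i)) ∈ ltvAccess B φ V t0 tf := by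
  refine ⟨fun s => ∑ i, (Ioc (a i) (b i)).indicator (fun _ => v i) s,
    Finset.measurable_sum _ fun i _ => measurable_const.indicator measurableSet_Ioc,
    fun s _ => ?_, ?_⟩
  · beta_reduce
    by_cases h : ∃ i, s ∈ Ioc (a i) (b i)
    · obtain ⟨i, hi⟩ := h
      rw [Finset.sum_eq_single i]
      · simpa [indicator_of_mem hi] using hv i
      · exact fun j _ hj => indicator_of_notMem (Set.disjoint_left.1 (hdisj i j hj.symm) hi) _
      · simp
    · push Not at h
      rw [Finset.sum_eq_zero fun i _ => indicator_of_notMem (h i) _]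
      exact hV0
  · have hcont : ∀ i, Continuous fun s => (φ tf s).mulVec ((B s).mulVec (v i)) := fun i =>
      hφ.matrix_mulVec (hB.matrix_mulVec continuous_const)
    have heq : ∀ s, (φ tf s).mulVec ((B s).mulVec
        (∑ i, (Ioc (a i) (b i)).indicator (fun _ => v i) s)) =
        ∑ i, (Ioc (a i) (b i)).indicator (fun s => (φ tf s).mulVec ((B s).mulVec (v i))) s := by
      intro s
      rw [Matrix.mulVec_sum, Matrix.mulVec_sum]
      refine Finset.sum_congr rfl fun i _ => ?_
      by_cases h : s ∈ Ioc (a i) (b i) <;> simp [h]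
    simp only [heq]
    rw [intervalIntegral.integral_of_le ht, integral_finsetSum]
    · refine Finset.sum_congr rfl fun i _ => ?_
      rw [intervalIntegral.integral_of_le (hab i), setIntegral_indicator measurableSet_Ioc,
        inter_eq_self_of_subset_right (hsub i)]
    · exact fun i _ => (((hcont i).integrableOn_Ioc).indicator measurableSet_Ioc)

/-- Proposition A.2: the image `P(𝖠^V_{t₀,t_f}(0))` of the accessible set of the
constrained linear time-varying system under a surjective linear map `P : ℝ^d → ℝⁿ`
is a neighborhood of the origin iff
`cone {P φ(t_f,s)B(s)v : s ∈ [t₀,t_f], v ∈ V} = ℝⁿ`. -/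
theorem ltv_projected_controllability_iff_cone
    {d n m : ℕ} (hnd : n ≤ d)
    (A : ℝ → Matrix (Fin d) (Fin d) ℝ) (B : ℝ → Matrix (Fin d) (Fin m) ℝ)
    (hA : ∀ i j, ContDiff ℝ (⊤ : ℕ∞) (fun t => A t i j))
    (hB : ∀ i j, ContDiff ℝ (⊤ : ℕ∞) (fun t => B t i j))
    (V : Set (Fin m → ℝ)) (hVcomp : IsCompact V) (hV0 : (0 : Fin m → ℝ) ∈ V)
    (t0 tf : ℝ) (ht : t0 < tf)
    (φ : ℝ → ℝ → Matrix (Fin d) (Fin d) ℝ)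
    (hφid : ∀ t, φ t t = 1)
    (hφmul : ∀ t1 t2 t3, φ t3 t2 * φ t2 t1 = φ t3 t1)
    (hφder : ∀ t1 t i j, HasDerivAt (fun s => φ s t1 i j) ((A t * φ t t1) i j) t)
    (P : (Fin d → ℝ) →ₗ[ℝ] (Fin n → ℝ)) (hP : Function.Surjective P) :
    P '' ltvAccess B φ V t0 tf ∈ nhds (0 : Fin n → ℝ) ↔
      coneHull {w : Fin n → ℝ | ∃ s ∈ Icc t0 tf, ∃ v ∈ V,
        w = P ((φ tf s).mulVec ((B s).mulVec v))} = univ := by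
  have hBc : Continuous B := continuous_matrix fun i j => (hB i j).continuous
  have hφc : Continuous (φ tf) := continuous_transition_snd hφid hφmul hφder tf
  let Q : (Fin d → ℝ) →L[ℝ] (Fin n → ℝ) := P.toContinuousLinearMap
  constructor
  · intro hnhds
    by_contra hne
    obtain ⟨f, hf, hfS⟩ := exists_ne_zero_forall_nonpos_of_coneHull_ne_univ hne
    have hle : ∀ y ∈ P '' ltvAccess B φ V t0 tf, f y ≤ 0 := by
      rintro _ ⟨_, ⟨v, -, hvV, rfl⟩, rfl⟩
      by_cases hint : IntervalIntegrable
          (fun s => (φ tf s).mulVec ((B s).mulVec (v s))) volume t0 tf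
      · change (f.comp Q) _ ≤ 0
        rw [← ContinuousLinearMap.intervalIntegral_comp_comm _ hint, ← neg_nonneg,
          ← intervalIntegral.integral_neg]
        exact intervalIntegral.integral_nonneg ht.le fun s hs =>
          neg_nonneg.2 (hfS _ ⟨s, hs, v s, hvV s hs, rfl⟩)
      · rw [intervalIntegral.integral_undef hint]
        simp
    apply hf
    ext1 x
    have hlim : Filter.Tendsto (fun r : ℝ => r • x) (nhds 0) (nhds 0) := by
      have hcont : Continuous fun r : ℝ => r • x := by fun_prop
      simpa using hcont.tendsto 0
    obtain ⟨r, hr, hball⟩ := Metric.eventually_nhds_iff.1 (hlim.eventually hnhds)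
    have h1 := hle _ (hball (y := r / 2) (by
      rw [Real.dist_eq, sub_zero, abs_of_pos (by linarith)]; linarith))
    have h2 := hle _ (hball (y := -(r / 2)) (by
      rw [Real.dist_eq, sub_zero, abs_neg, abs_of_pos (by linarith)]; linarith))
    simp only [map_smul, smul_eq_mul] at h1 h2
    simp only [zero_apply]
    nlinarith
  · intro hcone
    obtain ⟨ι, _, w, c, hwS, hc, hsum, hspan⟩ :=
      exists_pos_combination_eq_zero_of_coneHull_eq_univ hcone
    choose s hs v hv hw using hwS
    obtain ⟨δ, hδ, hcover⟩ := exists_forall_image_Icc_mem_nhds_zero hc hsum hspan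
    let G : ι → ℝ → Fin d → ℝ := fun i τ => (φ tf τ).mulVec ((B τ).mulVec (v i))
    have hG : ∀ i, Continuous (G i) := fun i =>
      hφc.matrix_mulVec (hBc.matrix_mulVec continuous_const)
    have hg : ∀ i, Continuous fun τ => Q (G i τ) := fun i => Q.continuous.comp (hG i)
    let δ' : ℝ := δ / (Fintype.card ι + 1)
    have hδ' : 0 < δ' := by positivity
    have hcard : Fintype.card ι * δ' ≤ δ := by
      rw [mul_div_assoc', div_le_iff₀ (by positivity)]
      nlinarith
    obtain ⟨a, ε, hε, haU, hdisj⟩ := exists_disjoint_intervals ht hs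
      (U := fun i => {τ | ‖Q (G i τ) - w i‖ ≤ δ'}) fun i => by
        have hnear := Metric.closedBall_mem_nhds (Q (G i (s i))) hδ'
        filter_upwards [(hg i).continuousAt hnear] with τ hτ
        rw [hw i]
        exact mem_closedBall_iff_norm.1 hτ
    have himage := hcover (fun h => ∑ i, ε⁻¹ • ∫ τ in a i..a i + ε * h i, Q (G i τ)) (by simp)
      fun h hh h' hh' =>
        (norm_sum_integral_sub_le hg hε hδ'.le (fun i τ hτ => (haU i hτ).1) hh hh').trans
          (by gcongr)
    refine Filter.mem_of_superset ((set_smul_mem_nhds_zero_iff hε.ne').2 himage) ?_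
    rintro _ ⟨_, ⟨h, hh, rfl⟩, rfl⟩
    have hbd : ∀ i, a i + ε * h i ≤ a i + ε := fun i =>
      add_le_add_right (mul_le_of_le_one_right hε.le (hh.2 i)) _
    have hab : ∀ i, a i ≤ a i + ε * h i := fun i =>
      le_add_of_nonneg_right (mul_nonneg hε.le (hh.1 i))
    have hshort : ∀ i, Ioc (a i) (a i + ε * h i) ⊆ Ioc (a i) (a i + ε) := fun i =>
      Ioc_subset_Ioc_right (hbd i)
    refine ⟨∑ i, ∫ τ in a i..a i + ε * h i, G i τ,
      sum_integral_mem_ltvAccess hV0 ht.le hBc hφc hv hab (fun i => (hshort i).trans ?_)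
        fun i j hij => (hdisj i j hij).mono (hshort i) (hshort j), ?_⟩
    · exact Ioc_subset_Ioc ((haU i) ⟨le_rfl, by linarith⟩).2.1
        ((haU i) ⟨by linarith, le_rfl⟩).2.2
    · simp only [map_sum, Finset.smul_sum, smul_smul, mul_inv_cancel₀ hε.ne', one_smul]
      exact Finset.sum_congr rfl fun i _ =>
        (Q.intervalIntegral_comp_comm ((hG i).intervalIntegrable _ _)).symm
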